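/- For d ∈ {3, 7, 11, 19, 43, 67, 163} and K = ℚ(√−d), there is no quadratic extension of K which is unramified at every prime ideal of O_K not dividing d. (Here d ramifies in K, and the condition says the extension is unramified away from the unique prime of K above d.) -/

import Mathlib

open NumberField

namespace NQ

lemma rat_int_of_mul_sq {d : ℕ} (hp : d.Prime) (r : ℚ) (n : ℤ) (h : (d : ℚ) * r ^ 2 = n) :
    ∃ c : ℤ, r = c := by
  have hd0 : (d : ℚ) ≠ 0 := by exact_mod_cast hp.ne_zero
  have h1 : IsIntegral ℤ ((d : ℚ) * r) := by
    apply IsIntegral.of_pow (n := 2) (by norm_num)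
    have : ((d : ℚ) * r) ^ 2 = algebraMap ℤ ℚ (d * n) := by
      simp; rw [← h]; ring
    rw [this]
    exact isIntegral_algebraMap
  obtain ⟨e, he⟩ := IsIntegrallyClosed.isIntegral_iff.mp h1
  simp at he
  have h2 : e ^ 2 = d * n := by
    have : ((e ^ 2 : ℤ) : ℚ) = ((d * n : ℤ) : ℚ) := by
      push_cast; rw [he, ← h]; ring
    exact_mod_cast this
  have h3 : (d : ℤ) ∣ e :=
    (Nat.prime_iff_prime_int.mp hp).dvd_of_dvd_pow (Dvd.intro _ h2.symm)
  obtain ⟨c, rfl⟩ := h3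
  refine ⟨c, ?_⟩
  push_cast at he
  exact (mul_left_cancel₀ hd0 he).symm

lemma norm_zero_imp {d : ℕ} {m : ℤ} (hdm : (d : ℤ) = 4 * m - 1) (hd : 0 < d)
    (z : QuadraticAlgebra ℚ (-(m : ℚ)) 1) (h : z.norm = 0) : z = 0 := by
  rw [QuadraticAlgebra.norm_def] at h
  have hm : (d : ℚ) = 4 * m - 1 := by exact_mod_cast congrArg (Int.cast : ℤ → ℚ) hdm
  have hd' : (0 : ℚ) < d := by exact_mod_cast hd
  have h4 : (2 * z.re + z.im) ^ 2 + d * z.im ^ 2 = 0 := by rw [hm]; linarith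
  have him : z.im = 0 := by
    by_contra h0
    have : 0 < z.im ^ 2 := by positivity
    nlinarith [sq_nonneg (2 * z.re + z.im), mul_pos hd' this]
  rw [him] at h4
  have hre : z.re = 0 := by nlinarith
  ext <;> simp [him, hre]

lemma exists_equiv (d : ℕ) (m : ℤ) (hdm : (d : ℤ) = 4 * m - 1) (hp : d.Prime)
    (K : Type) [Field K] [NumberField K]
    (s : K) (hs : s ^ 2 = -(d : K)) (hK : Module.finrank ℚ K = 2) :
    Nonempty (QuadraticAlgebra ℤ (-m) 1 ≃ₐ[ℤ] 𝓞 K) := by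
  have hmK : (d : K) = 4 * m - 1 := by exact_mod_cast congrArg (Int.cast : ℤ → K) hdm
  have hmQ : (d : ℚ) = 4 * m - 1 := by exact_mod_cast congrArg (Int.cast : ℤ → ℚ) hdm
  set w : K := (1 + s) / 2 with hw
  have hww : w * w = -(m : K) + w := by
    rw [hw]; field_simp; rw [hmK] at hs; linear_combination hs
  let f : QuadraticAlgebra ℚ (-(m : ℚ)) 1 →ₐ[ℚ] K :=
    QuadraticAlgebra.lift ⟨w, by rw [hww]; simp [Algebra.smul_def]⟩
  have hf : ∀ z, f z = (z.re : K) + z.im * w := by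
    intro z
    simp [f, QuadraticAlgebra.lift, Algebra.smul_def]
  have hinj : Function.Injective f := by
    rw [injective_iff_map_eq_zero]
    intro z hz
    apply norm_zero_imp hdm hp.pos
    have : f (algebraMap ℚ _ z.norm) = 0 := by
      rw [QuadraticAlgebra.algebraMap_norm_eq_mul_star, map_mul, hz, zero_mul]
    rw [AlgHom.commutes] at this
    simpa using this
  have hsurj : Function.Surjective f := by
    have := (LinearMap.injective_iff_surjective_of_finrank_eq_finrank
      (f := f.toLinearMap) (by rw [hK, QuadraticAlgebra.finrank_eq_two])).mp hinj
    exact this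
  let F := AlgEquiv.ofBijective f ⟨hinj, hsurj⟩
  have hwi : IsIntegral ℤ w := by
    refine ⟨Polynomial.X ^ 2 - Polynomial.X + Polynomial.C m, ?_, ?_⟩
    · monicity!
    · simp only [Polynomial.eval₂_add, Polynomial.eval₂_sub, Polynomial.eval₂_mul, Polynomial.eval₂_pow,
        Polynomial.eval₂_X, Polynomial.eval₂_C]
      simp; linear_combination hww
  let w0 : 𝓞 K := ⟨w, hwi⟩
  have hw0c : (w0 : K) = w := rfl
  have hw0 : w0 * w0 = (-m) • (1 : 𝓞 K) + (1 : ℤ) • w0 := by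
    apply RingOfIntegers.ext
    change w * w = _
    rw [hww]
    simp [hw0c]
  let g : QuadraticAlgebra ℤ (-m) 1 →ₐ[ℤ] 𝓞 K := QuadraticAlgebra.lift ⟨w0, hw0⟩
  have hg : ∀ z, ((g z : 𝓞 K) : K) = (z.re : K) + z.im * w := by
    intro z
    simp [g, QuadraticAlgebra.lift, hw0c]
  refine ⟨AlgEquiv.ofBijective g ⟨?_, ?_⟩⟩
  · intro a b hab
    have h1 : f ⟨a.re, a.im⟩ = f ⟨b.re, b.im⟩ := by
      rw [hf, hf]
      have := congrArg (fun x : 𝓞 K => (x : K)) hab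
      simp only [hg] at this
      simpa using this
    have h2 := hinj h1
    simp at h2
    ext
    · exact h2.1
    · exact h2.2
  · intro z
    obtain ⟨u, hu⟩ := hsurj (z : K)
    have hzi : IsIntegral ℤ (z : K) := z.2
    have hui : IsIntegral ℤ u := by
      rw [← hu] at hzi
      exact (isIntegral_algHom_iff (f.restrictScalars ℤ) hinj).mp hzi
    have hsi : IsIntegral ℤ (star u) := by
      have := hui.map (starRingEnd (QuadraticAlgebra ℚ (-(m : ℚ)) 1)).toIntAlgHom
      exact this
    have hinjQ : Function.Injective (algebraMap ℚ (QuadraticAlgebra ℚ (-(m : ℚ)) 1)) :=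
      QuadraticAlgebra.algebraMap_injective
    have ht : IsIntegral ℤ (u.trace) := by
      have := hui.add hsi
      rw [← QuadraticAlgebra.algebraMap_trace_eq_add_star] at this
      exact (isIntegral_algebraMap_iff hinjQ).mp this
    have hn : IsIntegral ℤ (u.norm) := by
      have := hui.mul hsi
      rw [← QuadraticAlgebra.algebraMap_norm_eq_mul_star] at this
      exact (isIntegral_algebraMap_iff hinjQ).mp this
    obtain ⟨A, hA⟩ := IsIntegrallyClosed.isIntegral_iff.mp ht
    obtain ⟨B, hB⟩ := IsIntegrallyClosed.isIntegral_iff.mp hn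
    simp [QuadraticAlgebra.trace_def] at hA
    simp [QuadraticAlgebra.norm_def] at hB
    obtain ⟨C, hC⟩ := rat_int_of_mul_sq hp u.im (4 * B - A ^ 2) (by
      push_cast; rw [hA, hB, hmQ]; ring)
    have hq : IsIntegral ℤ u.re := by
      refine ⟨Polynomial.X ^ 2 + Polynomial.C C * Polynomial.X +
        Polynomial.C (m * C * C - B), ?_, ?_⟩
      · monicity!
      · simp only [Polynomial.eval₂_add, Polynomial.eval₂_sub, Polynomial.eval₂_mul, Polynomial.eval₂_pow,
          Polynomial.eval₂_X, Polynomial.eval₂_C]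
        simp [hB, ← hC]; ring
    obtain ⟨E, hE⟩ := IsIntegrallyClosed.isIntegral_iff.mp hq
    refine ⟨⟨E, C⟩, RingOfIntegers.ext ?_⟩
    rw [hg, ← hu, hf, hC, ← hE]
    simp

lemma discr_eq (m : ℤ) (K : Type) [Field K] [NumberField K]
    (e : QuadraticAlgebra ℤ (-m) 1 ≃ₐ[ℤ] 𝓞 K) : discr K = 1 - 4 * m := by
  rw [← NumberField.discr_eq_discr K ((QuadraticAlgebra.basis (-m) 1).map e.toLinearEquiv)]
  have htr : ∀ z : QuadraticAlgebra ℤ (-m) 1, Algebra.trace ℤ _ z = 2 * z.re + z.im := by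
    intro z
    rw [Algebra.trace_eq_matrix_trace (QuadraticAlgebra.basis (-m) 1), Matrix.trace_fin_two]
    simp [Algebra.leftMulMatrix_apply, LinearMap.toMatrix_apply, QuadraticAlgebra.basis]
    ring
  have h2 := Algebra.discr_eq_discr_of_algEquiv (A := ℤ) (QuadraticAlgebra.basis (-m) 1) e
  have h3 : (⇑((QuadraticAlgebra.basis (-m) 1).map e.toLinearEquiv)) =
    ⇑e ∘ (QuadraticAlgebra.basis (-m) 1) := by
    ext i; simp
  rw [h3, ← h2, Algebra.discr_def, Matrix.det_fin_two]
  simp [Algebra.traceMatrix_apply, Algebra.traceForm_apply, htr, QuadraticAlgebra.basis]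
  ring

/-- The list of admissible pairs `(d, m)` with `d = 4 m - 1`. -/
def Good (d : ℕ) (m : ℤ) : Prop :=
  (d = 3 ∧ m = 1) ∨ (d = 7 ∧ m = 2) ∨ (d = 11 ∧ m = 3) ∨ (d = 19 ∧ m = 5) ∨
  (d = 43 ∧ m = 11) ∨ (d = 67 ∧ m = 17) ∨ (d = 163 ∧ m = 41)

lemma inert_aux (q : ℕ) (m : ℤ)
    (h : ∀ x y : ZMod q, x * x + x * y + m * y * y = 0 → x = 0 ∧ y = 0) (x y : ℤ)
    (hxy : (q : ℤ) ∣ x * x + x * y + m * y * y) : (q : ℤ) ∣ x ∧ (q : ℤ) ∣ y := by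
  rw [← CharP.intCast_eq_zero_iff (ZMod q) q] at hxy
  have := h x y (by exact_mod_cast hxy)
  exact ⟨(CharP.intCast_eq_zero_iff (ZMod q) q _).mp this.1,
    (CharP.intCast_eq_zero_iff (ZMod q) q _).mp this.2⟩

lemma inert {d : ℕ} {m : ℤ} (hg : Good d m) (q : ℕ) (hq : q.Prime) (hb : 9 * q ^ 2 ≤ 4 * d)
    (x y : ℤ) (hxy : (q : ℤ) ∣ x * x + x * y + m * y * y) : (q : ℤ) ∣ x ∧ (q : ℤ) ∣ y := by
  have h8 : q ≤ 8 := by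
    have : d ≤ 163 := by unfold Good at hg; omega
    by_contra h
    push Not at h
    nlinarith
  have h2 : q = 2 ∨ q = 3 ∨ q = 5 ∨ q = 7 := by
    interval_cases q <;> revert hq <;> decide
  apply inert_aux q m _ x y hxy
  clear hxy
  rcases hg with ⟨rfl, rfl⟩ | ⟨rfl, rfl⟩ | ⟨rfl, rfl⟩ | ⟨rfl, rfl⟩ | ⟨rfl, rfl⟩ | ⟨rfl, rfl⟩ |
    ⟨rfl, rfl⟩ <;> rcases h2 with rfl | rfl | rfl | rfl <;> first | omega | (push_cast; decide)

lemma good_dm {d : ℕ} {m : ℤ} (hg : Good d m) : (d : ℤ) = 4 * m - 1 := by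
  rcases hg with ⟨rfl, rfl⟩ | ⟨rfl, rfl⟩ | ⟨rfl, rfl⟩ | ⟨rfl, rfl⟩ | ⟨rfl, rfl⟩ | ⟨rfl, rfl⟩ |
    ⟨rfl, rfl⟩ <;> norm_num

lemma good_prime {d : ℕ} {m : ℤ} (hg : Good d m) : d.Prime := by
  rcases hg with ⟨rfl, rfl⟩ | ⟨rfl, rfl⟩ | ⟨rfl, rfl⟩ | ⟨rfl, rfl⟩ | ⟨rfl, rfl⟩ | ⟨rfl, rfl⟩ |
    ⟨rfl, rfl⟩ <;> norm_num

lemma isPID {d : ℕ} {m : ℤ} (hg : Good d m) (K : Type) [Field K] [NumberField K]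
    (hK : Module.finrank ℚ K = 2)
    (e : QuadraticAlgebra ℤ (-m) 1 ≃ₐ[ℤ] 𝓞 K) : IsPrincipalIdealRing (𝓞 K) := by
  apply RingOfIntegers.isPrincipalIdealRing_of_isPrincipal_of_norm_le_of_isPrime
  rintro ⟨P, hP0⟩ hP hN
  simp only at hP hN ⊢
  have hdm := good_dm hg
  have hdR : (d : ℝ) = 4 * m - 1 := by exact_mod_cast congrArg (Int.cast : ℤ → ℝ) hdm
  -- the bound
  have hr2 : InfinitePlace.nrComplexPlaces K ≤ 1 := by
    have := InfinitePlace.card_add_two_mul_card_eq_rank K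
    omega
  have hpi := Real.pi_gt_three
  have hbd : 9 * (Ideal.absNorm P) ^ 2 ≤ 4 * d := by
    have h1 : (4 / Real.pi) ^ InfinitePlace.nrComplexPlaces K ≤ 4 / 3 := by
      interval_cases InfinitePlace.nrComplexPlaces K
      · norm_num
      · rw [pow_one]; gcongr
    have h2 : (|discr K| : ℝ) = d := by
      rw [discr_eq m K e, hdR]
      push_cast
      rw [abs_of_nonpos] <;> [ring; skip]
      have : (0 : ℝ) ≤ d := by positivity
      linarith
    rw [hK] at hN
    have h3 : (Ideal.absNorm P : ℝ) ≤ 2 / 3 * √d := by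
      refine hN.trans ?_
      push_cast at h2 ⊢
      rw [h2]
      have h4 : (0 : ℝ) ≤ √d := Real.sqrt_nonneg _
      have : ((2 : ℕ).factorial : ℝ) = 2 := by norm_num [Nat.factorial]
      rw [this]
      calc _ ≤ (4 / 3 : ℝ) * (2 / 2 ^ 2 * √d) := by gcongr
        _ = _ := by ring
    have h5 : (√d : ℝ) ^ 2 = d := Real.sq_sqrt (by positivity)
    have h6 : (9 * (Ideal.absNorm P : ℝ) ^ 2) ≤ 4 * d := by
      have h0 : (0 : ℝ) ≤ Ideal.absNorm P := by positivity
      have := pow_le_pow_left₀ h0 h3 2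
      nlinarith
    exact_mod_cast h6
  have hPb : P ≠ ⊥ := by simpa using hP0
  have hn0 : Ideal.absNorm P ≠ 0 := by
    rw [Ne, Ideal.absNorm_eq_zero_iff]; exact hPb
  obtain ⟨q, hq, hqn, hqP⟩ : ∃ q : ℕ, q.Prime ∧ q ∣ Ideal.absNorm P ∧ (q : 𝓞 K) ∈ P := by
    have hmem := Ideal.absNorm_mem P
    have hkey : ∀ l : List ℕ, ((l.prod : ℕ) : 𝓞 K) ∈ P → ∃ q ∈ l, (q : 𝓞 K) ∈ P := by
      intro l
      induction l with
      | nil => intro h; exact absurd ((Ideal.eq_top_iff_one P).mpr (by simpa using h)) hP.ne_top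
      | cons a l ih =>
        intro h
        rw [List.prod_cons, Nat.cast_mul] at h
        rcases hP.mem_or_mem h with h | h
        · exact ⟨a, by simp, h⟩
        · obtain ⟨q, h1, h2⟩ := ih h
          exact ⟨q, by simp [h1], h2⟩
    obtain ⟨q, h1, h2⟩ := hkey (Ideal.absNorm P).primeFactorsList
      (by rwa [Nat.prod_primeFactorsList hn0])
    exact ⟨q, Nat.prime_of_mem_primeFactorsList h1, Nat.dvd_of_mem_primeFactorsList h1, h2⟩
  have hqb : 9 * q ^ 2 ≤ 4 * d := by
    have := Nat.le_of_dvd (Nat.pos_of_ne_zero hn0) hqn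
    nlinarith
  have hint : ∀ k : ℤ, (k : 𝓞 K) ∈ P → (q : ℤ) ∣ k := by
    intro k hk
    by_contra hnd
    have hcop : IsCoprime (q : ℤ) k :=
      (Prime.coprime_iff_not_dvd (Nat.prime_iff_prime_int.mp hq)).mpr hnd
    obtain ⟨u, v, huv⟩ := hcop
    apply hP.ne_top
    rw [Ideal.eq_top_iff_one]
    have h1 : (1 : 𝓞 K) = u * q + v * k := by
      have := congrArg (Int.cast : ℤ → 𝓞 K) huv
      push_cast at this
      exact this.symm
    rw [h1]
    exact P.add_mem (P.mul_mem_left _ hqP) (P.mul_mem_left _ hk)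
  refine ⟨⟨(q : 𝓞 K), ?_⟩⟩
  rw [Ideal.submodule_span_eq]
  apply le_antisymm
  · intro z hz
    obtain ⟨t, rfl⟩ := e.surjective z
    have hnorm : ((t.norm : ℤ) : 𝓞 K) ∈ P := by
      have h1 : ((t.norm : ℤ) : 𝓞 K) = e (algebraMap ℤ _ t.norm) := by
        rw [AlgEquiv.commutes]; simp
      rw [h1, QuadraticAlgebra.algebraMap_norm_eq_mul_star, map_mul]
      exact P.mul_mem_right _ hz
    have hdv := hint _ hnorm
    rw [QuadraticAlgebra.norm_def] at hdv
    obtain ⟨⟨x, hx⟩, ⟨y, hy⟩⟩ := inert hg q hq hqb t.re t.im (by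
      convert hdv using 1; ring)
    rw [Ideal.mem_span_singleton]
    refine ⟨e ⟨x, y⟩, ?_⟩
    have : t = (q : QuadraticAlgebra ℤ (-m) 1) * ⟨x, y⟩ := by
      ext <;> simp [hx, hy]
    rw [this, map_mul, map_natCast]
  · rw [Ideal.span_singleton_le_iff_mem]; exact hqP

/-- If `r` is squarefree in the PID `𝓞 K` and coprime to `d`, then `r` stays radical in `𝓞 L`. -/
lemma radical_up (d : ℕ) (K : Type) [Field K] [NumberField K] [IsPrincipalIdealRing (𝓞 K)]
    (L : Type) [Field L] [Algebra K L] [NumberField L]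
    (hunr : ∀ P : Ideal (𝓞 K), P.IsPrime → P ≠ ⊥ → (d : 𝓞 K) ∉ P →
      ∀ Q : Ideal (𝓞 L), Q.IsPrime → Q.comap (algebraMap (𝓞 K) (𝓞 L)) = P →
        Ideal.ramificationIdx' P Q = 1)
    (r : 𝓞 K) (hr0 : r ≠ 0) (hr : Squarefree r) (hc : IsCoprime r (d : 𝓞 K))
    (z : 𝓞 L) (hz : algebraMap (𝓞 K) (𝓞 L) r ∣ z ^ 2) : algebraMap (𝓞 K) (𝓞 L) r ∣ z := by
  have hinj : Function.Injective (algebraMap (𝓞 K) (𝓞 L)) :=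
    RingOfIntegers.algebraMap.injective K L
  set ρ := algebraMap (𝓞 K) (𝓞 L) r with hρ
  have hρ0 : ρ ≠ 0 := by
    rw [hρ]; exact (map_ne_zero_iff _ hinj).mpr hr0
  have hsq : Squarefree (Ideal.span {ρ}) := by
    rw [squarefree_iff_irreducible_sq_not_dvd_of_ne_zero (by simpa using hρ0)]
    intro Q hQ hdvd
    have hQp : Prime Q := hQ.prime
    have hQP : Q.IsPrime := Ideal.isPrime_of_prime hQp
    rw [Ideal.dvd_span_singleton, ← pow_two] at hdvd
    have hρQ : ρ ∈ Q := Ideal.pow_le_self (by norm_num) hdvd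
    have hrP : r ∈ Q.comap (algebraMap (𝓞 K) (𝓞 L)) := hρQ
    have hPp : (Q.comap (algebraMap (𝓞 K) (𝓞 L))).IsPrime := Ideal.IsPrime.comap _
    have hPb : Q.comap (algebraMap (𝓞 K) (𝓞 L)) ≠ ⊥ := by
      intro h
      rw [h] at hrP
      exact hr0 (by simpa using hrP)
    have hdP : (d : 𝓞 K) ∉ Q.comap (algebraMap (𝓞 K) (𝓞 L)) := by
      intro h
      obtain ⟨u, v, huv⟩ := hc
      apply hPp.ne_top
      rw [Ideal.eq_top_iff_one, ← huv]
      exact Ideal.add_mem _ (Ideal.mul_mem_left _ _ hrP) (Ideal.mul_mem_left _ _ h)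
    have hone := hunr _ hPp hPb hdP Q hQP rfl
    obtain ⟨π, hπ⟩ := (IsPrincipalIdealRing.principal (Q.comap (algebraMap (𝓞 K) (𝓞 L)))).principal
    rw [Ideal.submodule_span_eq] at hπ
    have hπr : π ∣ r := by
      rw [← Ideal.mem_span_singleton, ← hπ]; exact hrP
    obtain ⟨c, hcr⟩ := hπr
    have hcQ : algebraMap (𝓞 K) (𝓞 L) c ∉ Q := by
      intro h
      have : c ∈ Q.comap (algebraMap (𝓞 K) (𝓞 L)) := h
      rw [hπ, Ideal.mem_span_singleton] at this
      have hu : IsUnit π := hr π (by rw [hcr]; exact mul_dvd_mul_left _ this)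
      apply hPp.ne_top
      rw [hπ, Ideal.span_singleton_eq_top]
      exact hu
    have hπQ : algebraMap (𝓞 K) (𝓞 L) π ∈ Q ^ 2 := by
      rw [hρ, hcr, map_mul] at hdvd
      have := Ideal.IsPrime.mul_mem_pow Q (mul_comm (algebraMap (𝓞 K) (𝓞 L) π) _ ▸ hdvd)
      tauto
    refine (Ideal.ramificationIdx'_ne_one_iff ?_).mpr ?_ hone
    · rw [Ideal.map_le_iff_le_comap]
    · rw [hπ, Ideal.map_span, Set.image_singleton, Ideal.span_singleton_le_iff_mem]
      exact hπQ
  have hrad := hsq.isRadical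
  have := hrad 2 (Ideal.span {z}) (by
    rw [Ideal.span_singleton_pow, Ideal.dvd_span_singleton, Ideal.mem_span_singleton]; exact hz)
  rwa [Ideal.dvd_span_singleton, Ideal.mem_span_singleton] at this

/-- A quadratic extension contains a square root of a nonsquare integer. -/
lemma exists_sqrt (K : Type) [Field K] [NumberField K]
    (L : Type) [Field L] [Algebra K L] [NumberField L] (hdeg : Module.finrank K L = 2) :
    ∃ a : 𝓞 K, ¬ IsSquare a ∧ ∃ b : 𝓞 L, b ^ 2 = algebraMap (𝓞 K) (𝓞 L) a := by
  have hfin : FiniteDimensional K L := Module.finite_of_finrank_pos (by omega)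
  -- element outside K
  obtain ⟨z, hz⟩ : ∃ z : L, z ∉ Set.range (algebraMap K L) := by
    by_contra h
    push Not at h
    have h1 : (⊥ : Subalgebra K L) = ⊤ := by
      rw [eq_top_iff]
      intro x _
      exact Algebra.mem_bot.mpr (h x)
    have := Subalgebra.bot_eq_top_iff_finrank_eq_one.mp h1
    omega
  have hint : IsIntegral K z := IsIntegral.of_finite K z
  have hnd : (minpoly K z).natDegree = 2 := by
    have h1 := minpoly.natDegree_le (A := K) z
    have h2 := (minpoly.two_le_natDegree_iff hint).mpr (by simpa using hz)
    omega
  have hroot := minpoly.aeval K z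
  rw [Polynomial.aeval_eq_sum_range, hnd] at hroot
  have hlead : (minpoly K z).coeff 2 = 1 := by
    have := minpoly.monic hint
    rwa [Polynomial.Monic, Polynomial.leadingCoeff, hnd] at this
  simp only [Finset.sum_range_succ, Finset.sum_range_zero, hlead, Algebra.smul_def] at hroot
  set p := (minpoly K z).coeff 1
  set q := (minpoly K z).coeff 0
  have h2L : (2 : L) ≠ 0 := two_ne_zero
  set y : L := 2 * z + algebraMap K L p with hy
  have hyy : y ^ 2 = algebraMap K L (p ^ 2 - 4 * q) := by
    simp only [map_sub, map_mul, map_pow, map_ofNat]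
    simp at hroot
    rw [hy]; linear_combination 4 * hroot
  have hyK : y ∉ Set.range (algebraMap K L) := by
    rintro ⟨k, hk⟩
    apply hz
    refine ⟨(k - p) / 2, ?_⟩
    rw [map_div₀, map_sub, hk, hy, map_ofNat]
    field_simp
    ring
  -- clear denominators
  obtain ⟨⟨n, t⟩, hnt⟩ := IsLocalization.surj (nonZeroDivisors (𝓞 K)) (p ^ 2 - 4 * q)
  simp only at hnt
  set T : K := algebraMap (𝓞 K) K t with hT
  have hT0 : T ≠ 0 := by
    rw [hT]
    exact (map_ne_zero_iff _ RingOfIntegers.coe_injective).mpr (nonZeroDivisors.ne_zero t.2)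
  set w : L := algebraMap K L T * y with hw
  have hww : w ^ 2 = algebraMap K L (algebraMap (𝓞 K) K (n * t)) := by
    rw [hw, mul_pow, hyy, ← map_pow, ← map_mul]
    congr 1
    rw [map_mul, ← hnt, ← hT]; ring
  have hwi : IsIntegral ℤ w := by
    apply IsIntegral.of_pow (n := 2) (by norm_num)
    rw [hww]
    exact (RingOfIntegers.isIntegral_coe _).algebraMap
  refine ⟨n * t, ?_, ⟨w, hwi⟩, ?_⟩
  · rintro ⟨c, hc⟩
    have h1 : w ^ 2 = (algebraMap K L (algebraMap (𝓞 K) K c)) ^ 2 := by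
      rw [hww, hc, map_mul, map_mul]; ring
    have hTL : algebraMap K L T ≠ 0 := (map_ne_zero _).mpr hT0
    have hmem : w ∈ Set.range (algebraMap K L) := by
      rcases sq_eq_sq_iff_eq_or_eq_neg.mp h1 with h | h
      · exact ⟨_, h.symm⟩
      · exact ⟨-(algebraMap (𝓞 K) K c), by rw [h, map_neg]⟩
    obtain ⟨k, hk⟩ := hmem
    apply hyK
    refine ⟨k / T, ?_⟩
    rw [map_div₀, hk, hw]
    field_simp
  · apply RingOfIntegers.ext
    change w ^ 2 = _
    rw [hww]
    rfl

lemma dvd_down (K : Type) [Field K] [NumberField K]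
    (L : Type) [Field L] [Algebra K L] [NumberField L] (x y : 𝓞 K) (hx : x ≠ 0)
    (h : algebraMap (𝓞 K) (𝓞 L) x ∣ algebraMap (𝓞 K) (𝓞 L) y) : x ∣ y := by
  obtain ⟨c, hc⟩ := h
  have hcL : algebraMap K L (algebraMap (𝓞 K) K y) =
      algebraMap K L (algebraMap (𝓞 K) K x) * algebraMap (𝓞 L) L c := by
    have := congrArg (algebraMap (𝓞 L) L) hc
    rw [map_mul] at this
    exact this
  have hx0 : algebraMap (𝓞 K) K x ≠ 0 := (map_ne_zero_iff _ RingOfIntegers.coe_injective).mpr hx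
  have hxL : algebraMap K L (algebraMap (𝓞 K) K x) ≠ 0 := (map_ne_zero _).mpr hx0
  set k : K := algebraMap (𝓞 K) K y / algebraMap (𝓞 K) K x with hk
  have hkc : algebraMap K L k = algebraMap (𝓞 L) L c := by
    rw [hk, map_div₀, hcL]; field_simp
  have hki : IsIntegral ℤ k := by
    have h1 : IsIntegral ℤ (algebraMap K L k) := by
      rw [hkc]; exact RingOfIntegers.isIntegral_coe c
    exact (isIntegral_algebraMap_iff (algebraMap K L).injective).mp h1
  refine ⟨⟨k, hki⟩, RingOfIntegers.ext ?_⟩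
  change algebraMap (𝓞 K) K y = algebraMap (𝓞 K) K x * k
  rw [hk]; field_simp

lemma int_sq_one {u : ℤ} (h : u ^ 2 = 1) : u = 1 ∨ u = -1 := by
  rw [← one_pow 2] at h
  exact sq_eq_sq_iff_eq_or_eq_neg.mp h

lemma four_norm {d : ℕ} {m : ℤ} (hdm : (d : ℤ) = 4 * m - 1) (t : QuadraticAlgebra ℤ (-m) 1) :
    4 * t.norm = (2 * t.re + t.im) ^ 2 + d * t.im ^ 2 := by
  rw [QuadraticAlgebra.norm_def, hdm]; ring

lemma norm_nonneg {d : ℕ} {m : ℤ} (hdm : (d : ℤ) = 4 * m - 1) (t : QuadraticAlgebra ℤ (-m) 1) :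
    0 ≤ t.norm := by
  have := four_norm hdm t
  have h2 : 0 ≤ (2 * t.re + t.im) ^ 2 + (d : ℤ) * t.im ^ 2 := by positivity
  omega

lemma norm_unit {d : ℕ} {m : ℤ} (hdm : (d : ℤ) = 4 * m - 1) (t : QuadraticAlgebra ℤ (-m) 1)
    (h : IsUnit t) : t.norm = 1 := by
  have h1 := QuadraticAlgebra.isUnit_iff_norm_isUnit.mp h
  have h2 := norm_nonneg hdm t
  rcases Int.isUnit_iff.mp h1 with h | h <;> omega

lemma two_dvd_iff {m : ℤ} (n : ℤ) (t : QuadraticAlgebra ℤ (-m) 1) :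
    (n : QuadraticAlgebra ℤ (-m) 1) ∣ t ↔ n ∣ t.re ∧ n ∣ t.im := by
  have := QuadraticAlgebra.algebraMap_dvd_iff (a := -m) (b := (1 : ℤ)) (r := n) (z := t)
  rw [← this]
  simp

lemma exists_sqrt_mod_two {m : ℤ} (t : QuadraticAlgebra ℤ (-m) 1) :
    ∃ x, (2 : QuadraticAlgebra ℤ (-m) 1) ∣ t - x ^ 2 := by
  refine ⟨⟨t.re + m * t.im, t.im⟩, ?_⟩
  have h := two_dvd_iff 2 (t - (⟨t.re + m * t.im, t.im⟩ : QuadraticAlgebra ℤ (-m) 1) ^ 2)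
  rw [Int.cast_ofNat] at h
  rw [h]
  simp only [pow_two, QuadraticAlgebra.re_sub, QuadraticAlgebra.im_sub, QuadraticAlgebra.re_mul,
    QuadraticAlgebra.im_mul]
  constructor
  · rw [← even_iff_two_dvd]
    rcases Int.even_or_odd t.re with h1 | h1 <;> rcases Int.even_or_odd t.im with h2 | h2 <;>
      rcases Int.even_or_odd m with h3 | h3 <;> simp [h1, h2, h3, parity_simps, ← Int.not_even_iff_odd]
        <;> simp_all [← Int.not_even_iff_odd]
  · rw [← even_iff_two_dvd]
    rcases Int.even_or_odd t.re with h1 | h1 <;> rcases Int.even_or_odd t.im with h2 | h2 <;>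
      rcases Int.even_or_odd m with h3 | h3 <;> simp [h1, h2, h3, parity_simps, ← Int.not_even_iff_odd]
        <;> simp_all [← Int.not_even_iff_odd]

lemma two_sqfree {m : ℤ} : Squarefree (2 : QuadraticAlgebra ℤ (-m) 1) := by
  intro y hy
  obtain ⟨w, hw⟩ := hy
  have h2 : (2 : QuadraticAlgebra ℤ (-m) 1) ∣ y * w := by
    have h3 : (2 : QuadraticAlgebra ℤ (-m) 1) ∣ (y * w) * (y * w) :=
      ⟨w, by rw [hw]; ring⟩
    generalize y * w = v at h3
    have ha := two_dvd_iff 2 (v * v)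
    have hb := two_dvd_iff 2 v
    rw [Int.cast_ofNat] at ha hb
    rw [ha] at h3
    rw [hb]
    simp only [QuadraticAlgebra.re_mul, QuadraticAlgebra.im_mul] at h3
    obtain ⟨h3, h4⟩ := h3
    have him : (2 : ℤ) ∣ v.im := by
      apply Int.prime_two.dvd_of_dvd_pow (n := 2)
      have : v.im ^ 2 = (v.re * v.im + v.im * v.re + 1 * v.im * v.im) - 2 * (v.re * v.im) := by ring
      rw [this]
      exact dvd_sub h4 (dvd_mul_right _ _)
    refine ⟨?_, him⟩
    apply Int.prime_two.dvd_of_dvd_pow (n := 2)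
    have : v.re ^ 2 = (v.re * v.re + -m * v.im * v.im) - v.im * (-m * v.im) := by ring
    rw [this]
    exact dvd_sub h3 (him.mul_right _)
  obtain ⟨v, hv⟩ := h2
  apply IsUnit.of_mul_eq_one v
  have hre := congrArg QuadraticAlgebra.re hw
  have him := congrArg QuadraticAlgebra.im hw
  have : y * y * w = 2 * (y * v) := by rw [mul_assoc, hv]; ring
  rw [this] at hre him
  generalize y * v = q at hre him
  have e1 : (2 * q).re = 2 * q.re := by rw [two_mul, QuadraticAlgebra.re_add, two_mul]
  have e2 : (2 * q).im = 2 * q.im := by rw [two_mul, QuadraticAlgebra.im_add, two_mul]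
  have e3 : (2 : QuadraticAlgebra ℤ (-m) 1).re = 2 := rfl
  have e4 : (2 : QuadraticAlgebra ℤ (-m) 1).im = 0 := rfl
  rw [e3, e1] at hre
  rw [e4, e2] at him
  ext
  · rw [QuadraticAlgebra.re_one]; omega
  · rw [QuadraticAlgebra.im_one]; omega

lemma arith {d : ℕ} {m : ℤ} (hg : Good d m) (t x : QuadraticAlgebra ℤ (-m) 1)
    (h4 : (4 : QuadraticAlgebra ℤ (-m) 1) ∣ t - x ^ 2) (hn : t.norm = 1 ∨ t.norm = d) :
    IsSquare t := by
  have hdm := good_dm hg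
  have hN := four_norm hdm t
  have h := two_dvd_iff 4 (t - x ^ 2)
  rw [Int.cast_ofNat] at h
  rw [h] at h4
  simp only [pow_two, QuadraticAlgebra.re_sub, QuadraticAlgebra.im_sub, QuadraticAlgebra.re_mul,
    QuadraticAlgebra.im_mul] at h4
  obtain ⟨⟨c1, h1⟩, ⟨c2, h2⟩⟩ := h4
  obtain ⟨p, q⟩ := x
  obtain ⟨u, v⟩ := t
  simp only at h1 h2 hN
  rcases hn with hn | hn
  · rw [hn] at hN
    have hv : v ^ 2 ≤ 1 := by
      have : 3 ≤ (d : ℤ) := by unfold Good at hg; omega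
      nlinarith [sq_nonneg (2 * u + v), sq_nonneg v]
    have hv1 : -1 ≤ v := by nlinarith
    have hv2 : v ≤ 1 := by nlinarith
    -- the case `-1` (and similar) is excluded by a computation modulo 4
    have key : ∀ u0 v0 m0 p q : ZMod 4, u0 - (p * p + -m0 * q * q) = 0 →
        v0 - (p * q + q * p + 1 * q * q) = 0 →
        ¬ (u0 = -1 ∧ v0 = 0) ∧ (m0 = 1 → ¬ (u0 = 1 ∧ v0 = -1) ∧ ¬ (u0 = 0 ∧ v0 = 1)) := by
      decide
    have k := key u v m p q
      (by
        have := congrArg (Int.cast : ℤ → ZMod 4) h1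
        push_cast at this
        rw [this, show (4 : ZMod 4) = 0 from rfl, zero_mul])
      (by
        have := congrArg (Int.cast : ℤ → ZMod 4) h2
        push_cast at this
        rw [this, show (4 : ZMod 4) = 0 from rfl, zero_mul])
    have hd : (d = 3 ∧ m = 1) ∨ 7 ≤ (d : ℤ) := by unfold Good at hg; omega
    have hv0 : v = 0 ∨ (d = 3 ∧ m = 1 ∧ v ^ 2 = 1) := by
      rcases hd with ⟨h3, h3'⟩ | h7
      · have : v = 0 ∨ v = 1 ∨ v = -1 := by omega
        rcases this with h | h | h <;> simp [h, h3, h3']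
      · left
        by_contra h0
        have : 1 ≤ v ^ 2 := by
          have := sq_nonneg v
          have h' : v ^ 2 ≠ 0 := by positivity
          omega
        nlinarith [sq_nonneg (2 * u + v)]
    rcases hv0 with rfl | ⟨rfl, rfl, hvv⟩
    · have : u ^ 2 = 1 := by nlinarith
      rcases int_sq_one this with rfl | rfl
      · exact ⟨1, by ext <;> simp [QuadraticAlgebra.re_one, QuadraticAlgebra.im_one]⟩
      · exfalso; apply k.1; simp
    · have h5 : (2 * u + v) ^ 2 = 1 := by rw [hvv] at hN; push_cast at hN; linarith
      have k2 := k.2 (by simp)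
      have hv' : v = 1 ∨ v = -1 := int_sq_one hvv
      have hu' : 2 * u + v = 1 ∨ 2 * u + v = -1 := int_sq_one h5
      rcases hv' with rfl | rfl <;> rcases hu' with hu | hu
      · obtain rfl : u = 0 := by omega
        exfalso; apply k2.2; simp
      · obtain rfl : u = -1 := by omega
        exact ⟨⟨0, 1⟩, by ext <;> simp⟩
      · obtain rfl : u = 1 := by omega
        exfalso; apply k2.1; simp
      · obtain rfl : u = 0 := by omega
        exact ⟨⟨-1, 1⟩, by ext <;> simp⟩
  · exfalso
    rw [QuadraticAlgebra.norm_def] at hn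
    simp only at hn
    have hn' : u * u + 1 * u * v - -m * v * v = 4 * m - 1 := by rw [hn, hdm]
    have key : ∀ u0 v0 m0 p q : ZMod 4, u0 - (p * p + -m0 * q * q) = 0 →
        v0 - (p * q + q * p + 1 * q * q) = 0 →
        u0 * u0 + 1 * u0 * v0 - -m0 * v0 * v0 ≠ -1 := by
      decide
    refine key u v m p q
      (by
        have := congrArg (Int.cast : ℤ → ZMod 4) h1
        push_cast at this
        rw [this, show (4 : ZMod 4) = 0 from rfl, zero_mul])
      (by
        have := congrArg (Int.cast : ℤ → ZMod 4) h2
        push_cast at this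
        rw [this, show (4 : ZMod 4) = 0 from rfl, zero_mul]) ?_
    have := congrArg (Int.cast : ℤ → ZMod 4) hn'
    push_cast at this
    rw [this, show (4 : ZMod 4) = 0 from rfl, zero_mul, zero_sub]

lemma assoc_sigma {d : ℕ} {m : ℤ} (hg : Good d m) (K : Type) [Field K] [NumberField K]
    (e : QuadraticAlgebra ℤ (-m) 1 ≃ₐ[ℤ] 𝓞 K) (π : 𝓞 K) (hπ : Prime π) (hd : π ∣ (d : 𝓞 K)) :
    Associated π (e ⟨-1, 2⟩) := by
  have hdm := good_dm hg
  have h1 : (e ⟨-1, 2⟩) ^ 2 = -(d : 𝓞 K) := by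
    rw [← map_pow, ← map_natCast e d, ← map_neg]
    congr 1
    ext
    · simp [pow_two, hdm]; ring
    · simp [pow_two]
  have h2 : π ∣ e ⟨-1, 2⟩ := hπ.dvd_of_dvd_pow (n := 2) (by rw [h1]; exact (dvd_neg).mpr hd)
  obtain ⟨u, hu⟩ := h2
  have hnu : (e.symm π).norm * (e.symm u).norm = d := by
    rw [← map_mul, ← map_mul, ← hu, AlgEquiv.symm_apply_apply, QuadraticAlgebra.norm_def, hdm]
    ring
  have hirr : Irreducible (d : ℤ) := (Nat.prime_iff_prime_int.mp (good_prime hg)).irreducible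
  have huu : IsUnit u := by
    rcases hirr.isUnit_or_isUnit hnu.symm with h | h
    · exfalso
      apply hπ.not_isUnit
      have := (QuadraticAlgebra.isUnit_iff_norm_isUnit.mpr h).map e
      simpa using this
    · have := (QuadraticAlgebra.isUnit_iff_norm_isUnit.mpr h).map e
      simpa using this
  obtain ⟨v, rfl⟩ := huu
  exact ⟨v, hu.symm⟩

lemma norm_classify {d : ℕ} {m : ℤ} (hg : Good d m) (K : Type) [Field K] [NumberField K]
    [IsPrincipalIdealRing (𝓞 K)]
    (e : QuadraticAlgebra ℤ (-m) 1 ≃ₐ[ℤ] 𝓞 K) (a : 𝓞 K) (ha0 : a ≠ 0) (hsq : Squarefree a)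
    (hp : ∀ π, Prime π → π ∣ a → π ∣ (d : 𝓞 K)) :
    (e.symm a).norm = 1 ∨ (e.symm a).norm = d := by
  have hdm := good_dm hg
  by_cases hu : IsUnit a
  · left
    exact norm_unit hdm _ (hu.map e.symm)
  · right
    obtain ⟨π, hπ, hπa⟩ := WfDvdMonoid.exists_irreducible_factor hu ha0
    have hπp := hπ.prime
    have hA := assoc_sigma hg K e π hπp (hp π hπp hπa)
    obtain ⟨c, hc⟩ := hπa
    have hcu : IsUnit c := by
      by_contra hcu
      have hc0 : c ≠ 0 := by rintro rfl; simp at hc; exact ha0 hc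
      obtain ⟨π', hπ', hπc⟩ := WfDvdMonoid.exists_irreducible_factor hcu hc0
      have hA' := assoc_sigma hg K e π' hπ'.prime
        (hp π' hπ'.prime (by rw [hc]; exact hπc.mul_left _))
      have : π ∣ c := ((hA.trans hA'.symm).dvd).trans hπc
      exact hπp.not_unit (hsq π (by rw [hc]; exact mul_dvd_mul_left _ this))
    obtain ⟨v, hv⟩ := hA
    have h1 : (e.symm a).norm = (e.symm π).norm := by
      rw [hc, map_mul, map_mul, norm_unit hdm _ (hcu.map e.symm), mul_one]
    have h2 : (e.symm π).norm = (e.symm (e ⟨-1, 2⟩)).norm := by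
      rw [← hv, map_mul, map_mul, norm_unit hdm _ (v.isUnit.map e.symm), mul_one]
    rw [h1, h2, AlgEquiv.symm_apply_apply, QuadraticAlgebra.norm_def, hdm]
    ring

theorem main {d : ℕ} {m : ℤ} (hg : Good d m)
    (K : Type) [Field K] [NumberField K]
    (s : K) (hs : s ^ 2 = -(d : K)) (hK : Module.finrank ℚ K = 2)
    (L : Type) [Field L] [Algebra K L] [NumberField L]
    (hdeg : Module.finrank K L = 2)
    (hunr : ∀ P : Ideal (𝓞 K), P.IsPrime → P ≠ ⊥ → (d : 𝓞 K) ∉ P →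
      ∀ Q : Ideal (𝓞 L), Q.IsPrime → Q.comap (algebraMap (𝓞 K) (𝓞 L)) = P →
        Ideal.ramificationIdx' P Q = 1) :
    False := by
  have hdm := good_dm hg
  obtain ⟨e⟩ := exists_equiv d m hdm (good_prime hg) K s hs hK
  have hPID := isPID hg K hK e
  have hinj : Function.Injective (algebraMap (𝓞 K) (𝓞 L)) :=
    RingOfIntegers.algebraMap.injective K L
  obtain ⟨a, ⟨hns, b, hb⟩, hmin⟩ := (wellFounded_dvdNotUnit (α := 𝓞 K)).has_min
    {a | ¬ IsSquare a ∧ ∃ b : 𝓞 L, b ^ 2 = algebraMap (𝓞 K) (𝓞 L) a} (exists_sqrt K L hdeg)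
  have ha0 : a ≠ 0 := by rintro rfl; exact hns ⟨0, by simp⟩
  have hsqf : Squarefree a := by
    intro π hπ
    by_contra hu
    obtain ⟨c, hc⟩ := hπ
    have hπ0 : π ≠ 0 := by rintro rfl; simp at hc; exact ha0 hc
    have hc0 : c ≠ 0 := by rintro rfl; simp at hc; exact ha0 hc
    have hdv : algebraMap (𝓞 K) (𝓞 L) π ∣ b := by
      rw [← IsIntegrallyClosed.pow_dvd_pow_iff (n := 2) (by norm_num), hb, hc, map_mul, map_mul,
        pow_two]
      exact dvd_mul_right _ _
    obtain ⟨b', hb'⟩ := hdv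
    refine hmin c ⟨?_, b', ?_⟩ ⟨hc0, π * π, ?_, by rw [hc]; ring⟩
    · rintro ⟨t, ht⟩
      exact hns ⟨π * t, by rw [hc, ht]; ring⟩
    · have h0 : (algebraMap (𝓞 K) (𝓞 L) π) ^ 2 ≠ 0 :=
        pow_ne_zero _ ((map_ne_zero_iff _ hinj).mpr hπ0)
      apply mul_left_cancel₀ h0
      rw [← mul_pow, ← hb', hb, hc, map_mul, map_mul, pow_two]
    · intro h
      exact hu (isUnit_of_mul_isUnit_left h)
  have hpd : ∀ π, Prime π → π ∣ a → π ∣ (d : 𝓞 K) := by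
    intro π hπ hπa
    by_contra hnd
    have hcop : IsCoprime π (d : 𝓞 K) := (Irreducible.coprime_iff_not_dvd hπ.irreducible).mpr hnd
    have h1 := radical_up d K L hunr π hπ.ne_zero hπ.irreducible.squarefree hcop b
      (by rw [hb]; exact map_dvd _ hπa)
    have h2 : π * π ∣ a := by
      apply dvd_down K L _ _ (mul_ne_zero hπ.ne_zero hπ.ne_zero)
      rw [map_mul, ← hb, pow_two]
      exact mul_dvd_mul h1 h1
    exact hπ.not_isUnit (hsqf π h2)
  have hnorm := norm_classify hg K e a ha0 hsqf hpd
  -- the prime two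
  have q2 : (2 : QuadraticAlgebra ℤ (-m) 1) = ((2 : ℕ) : QuadraticAlgebra ℤ (-m) 1) := rfl
  have q4 : (4 : QuadraticAlgebra ℤ (-m) 1) = ((4 : ℕ) : QuadraticAlgebra ℤ (-m) 1) := rfl
  have e2 : e 2 = 2 := by rw [q2, map_natCast]; norm_num
  have e4 : e 4 = 4 := by rw [q4, map_natCast]; norm_num
  have e2' : e.symm 2 = 2 := by rw [← e2, AlgEquiv.symm_apply_apply]
  have e4' : e.symm 4 = 4 := by rw [← e4, AlgEquiv.symm_apply_apply]
  obtain ⟨x₀, hx₀⟩ := exists_sqrt_mod_two (e.symm a)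
  have hx : (2 : 𝓞 K) ∣ a - (e x₀) ^ 2 := by
    have := map_dvd e hx₀
    rwa [e2, map_sub, map_pow, AlgEquiv.apply_symm_apply] at this
  have h2sq : Squarefree (2 : 𝓞 K) := by
    intro y hy
    have h1 : e.symm y * e.symm y ∣ 2 := by
      have := map_dvd e.symm hy
      rwa [e2', map_mul] at this
    have := (two_sqfree (e.symm y) h1).map e
    simpa using this
  have h2cop : IsCoprime (2 : 𝓞 K) (d : 𝓞 K) := by
    refine ⟨2 * m, -1, ?_⟩
    have : (d : 𝓞 K) = 4 * m - 1 := by exact_mod_cast congrArg (Int.cast : ℤ → 𝓞 K) hdm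
    rw [this]; ring
  set X := algebraMap (𝓞 K) (𝓞 L) (e x₀) with hX
  have hbx : (2 : 𝓞 L) ∣ b - X := by
    have := radical_up d K L hunr 2 two_ne_zero h2sq h2cop (b - X) (by
      obtain ⟨c, hc⟩ := hx
      refine ⟨algebraMap (𝓞 K) (𝓞 L) c + X ^ 2 - b * X, ?_⟩
      have h3 := congrArg (algebraMap (𝓞 K) (𝓞 L)) hc
      rw [map_sub, map_pow, ← hb, map_mul, map_ofNat, ← hX] at h3
      rw [map_ofNat]
      linear_combination h3)
    rwa [map_ofNat] at this
  have h4 : (4 : 𝓞 K) ∣ a - (e x₀) ^ 2 := by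
    apply dvd_down K L _ _ (by norm_num)
    obtain ⟨β, hβ⟩ := hbx
    refine ⟨β * (β + X), ?_⟩
    rw [map_sub, map_pow, ← hb, map_ofNat, ← hX]
    linear_combination (b + X + 2 * β) * hβ
  have h4' : (4 : QuadraticAlgebra ℤ (-m) 1) ∣ e.symm a - x₀ ^ 2 := by
    have := map_dvd e.symm h4
    rwa [e4', map_sub, map_pow, AlgEquiv.symm_apply_apply] at this
  obtain ⟨r, hr⟩ := arith hg _ _ h4' hnorm
  apply hns
  refine ⟨e r, ?_⟩
  rw [← map_mul, ← hr, AlgEquiv.apply_symm_apply]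

end NQ

/-- For `d ∈ {3, 7, 11, 19, 43, 67, 163}` and `K = ℚ(√-d)`, there is no quadratic extension
of `K` unramified at every prime ideal of `O_K` not dividing `d`. -/
theorem no_quadratic_extension_unramified_outside_d
    (d : ℕ) (hd : d ∈ ({3, 7, 11, 19, 43, 67, 163} : Finset ℕ))
    (K : Type) [Field K] [NumberField K]
    (s : K) (hs : s ^ 2 = -(d : K)) (hK : Module.finrank ℚ K = 2)
    (L : Type) [Field L] [Algebra K L] [NumberField L]
    (hdeg : Module.finrank K L = 2)
    (hunr : ∀ P : Ideal (𝓞 K), P.IsPrime → P ≠ ⊥ → (d : 𝓞 K) ∉ P →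
      ∀ Q : Ideal (𝓞 L), Q.IsPrime → Q.comap (algebraMap (𝓞 K) (𝓞 L)) = P →
        Ideal.ramificationIdx' P Q = 1) :
    False := by
  have hex : ∃ m : ℤ, NQ.Good d m := by
    simp only [Finset.mem_insert, Finset.mem_singleton] at hd
    unfold NQ.Good
    rcases hd with rfl | rfl | rfl | rfl | rfl | rfl | rfl
    · exact ⟨1, by norm_num⟩
    · exact ⟨2, by norm_num⟩
    · exact ⟨3, by norm_num⟩
    · exact ⟨5, by norm_num⟩
    · exact ⟨11, by norm_num⟩
    · exact ⟨17, by norm_num⟩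
    · exact ⟨41, by norm_num⟩
  obtain ⟨m, hg⟩ := hex
  exact NQ.main hg K s hs hK L hdeg hunr
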